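/- Let U be a finite list of insertions and deletions of items processed by the Count-Min sketch starting from the all-zero state, and suppose the net frequency f_U(e') = (number of insertions of e' in U) − (number of deletions of e' in U) is nonnegative for every item e'. Then the Count-Min query never underestimates: for every item e, min over i : Fin d of T i (g i e) ≥ f_U(e). (The no-under-estimation property of the Count-Min sketch used for the Fat-subsketch in Appendix II.) -/

import Mathlib

/-- An update operation: insertion or deletion of an item. -/
inductive SketchOp (ι : Type) where
  | ins (e : ι)
  | del (e : ι)
deriving DecidableEq

/-- One update step of the Count-Min sketch with integer counters: inserting an
item `e` adds 1 to each counter `T i (g i e)`, and deleting `e` subtracts 1 from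
each counter `T i (g i e)`. -/
def cmStep {ι : Type} {d w : ℕ} (g : Fin d → ι → Fin w)
    (T : Fin d → Fin w → ℤ) : SketchOp ι → Fin d → Fin w → ℤ
  | .ins e => fun i j => if j = g i e then T i j + 1 else T i j
  | .del e => fun i j => if j = g i e then T i j - 1 else T i j

/-- The Count-Min sketch state after processing the update sequence `U`
starting from the all-zero state. -/
def cmProcess {ι : Type} {d w : ℕ} (g : Fin d → ι → Fin w)
    (U : List (SketchOp ι)) : Fin d → Fin w → ℤ :=
  U.foldl (cmStep g) (fun _ _ => 0)

/-- The item an operation acts on. -/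
def opItem {ι : Type} : SketchOp ι → ι
  | .ins e => e
  | .del e => e

/-- Each counter is the sum of the net frequencies of the items hashed to it. -/
theorem cm_foldl_eq {ι : Type} [DecidableEq ι] {d w : ℕ} (g : Fin d → ι → Fin w)
    (S : Finset ι) (i : Fin d) (j : Fin w) (U : List (SketchOp ι)) :
    ∀ (T : Fin d → Fin w → ℤ), (∀ o ∈ U, opItem o ∈ S) →
    U.foldl (cmStep g) T i j = T i j + ∑ x ∈ S, if j = g i x then
      ((U.count (SketchOp.ins x) : ℤ) - (U.count (SketchOp.del x) : ℤ)) else 0 := by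
  induction U with
  | nil => intro T _; simp
  | cons o U ih =>
    intro T h
    rw [List.foldl_cons, ih _ (fun o ho => h o (List.mem_cons_of_mem _ ho))]
    have ho := h o List.mem_cons_self
    cases o with
    | ins e =>
      have key : ∀ x, (if j = g i x then (((SketchOp.ins e :: U).count (SketchOp.ins x) : ℤ)
          - ((SketchOp.ins e :: U).count (SketchOp.del x) : ℤ)) else 0)
          = (if j = g i x then ((U.count (SketchOp.ins x) : ℤ)
            - (U.count (SketchOp.del x) : ℤ)) else 0)
            + (if e = x then (if j = g i e then 1 else 0) else 0) := by
        intro x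
        by_cases hx : e = x
        · subst hx
          by_cases hj : j = g i e <;> simp [hj]
          ring
        · simp [hx]
      have he : e ∈ S := ho
      simp only [key, Finset.sum_add_distrib, Finset.sum_ite_eq, he, if_true, cmStep]
      split_ifs <;> ring
    | del e =>
      have key : ∀ x, (if j = g i x then (((SketchOp.del e :: U).count (SketchOp.ins x) : ℤ)
          - ((SketchOp.del e :: U).count (SketchOp.del x) : ℤ)) else 0)
          = (if j = g i x then ((U.count (SketchOp.ins x) : ℤ)
            - (U.count (SketchOp.del x) : ℤ)) else 0)
            + (if e = x then (if j = g i e then -1 else 0) else 0) := by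
        intro x
        by_cases hx : e = x
        · subst hx
          by_cases hj : j = g i e <;> simp [hj]
          ring
        · simp [hx]
      have he : e ∈ S := ho
      simp only [key, Finset.sum_add_distrib, Finset.sum_ite_eq, he, if_true, cmStep]
      split_ifs <;> ring

/-- No-under-estimation property of the Count-Min sketch: if every item's net
frequency over `U` (insertions minus deletions) is nonnegative, then for every
item `e` the Count-Min query (the minimum of the `d` hashed counters) is at
least the net frequency of `e`. -/
theorem cm_no_underestimation {ι : Type} [DecidableEq ι] {d w : ℕ}
    [NeZero d] [NeZero w] (g : Fin d → ι → Fin w) (U : List (SketchOp ι))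
    (hnet : ∀ e' : ι, U.count (SketchOp.del e') ≤ U.count (SketchOp.ins e')) :
    ∀ e : ι,
      (U.count (SketchOp.ins e) : ℤ) - (U.count (SketchOp.del e) : ℤ)
        ≤ Finset.univ.inf' Finset.univ_nonempty
            (fun i : Fin d => cmProcess g U i (g i e)) := by
  intro e
  apply Finset.le_inf'
  intro i _
  rw [cmProcess, cm_foldl_eq g (insert e (U.map opItem).toFinset) i (g i e) U _
    (fun o ho => Finset.mem_insert_of_mem (List.mem_toFinset.2 (List.mem_map_of_mem ho)))]
  have h := Finset.single_le_sum (s := insert e (U.map opItem).toFinset)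
    (f := fun x => if g i e = g i x then
      ((U.count (SketchOp.ins x) : ℤ) - (U.count (SketchOp.del x) : ℤ)) else 0)
    (fun x _ => by
      have := hnet x
      split_ifs
      · omega
      · exact le_rfl) (Finset.mem_insert_self e _)
  simpa using h
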